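/- arXiv:2410.21906 — 4 statements merged into one kernel-verified Lean document; each statement's English description precedes it below -/
import Mathlib

section
/- Hartwig–Spindelböck decomposition of a dual complex matrix: for every square matrix Â of size n over the dual complex numbers 𝔻ℂ, there exist natural numbers r and s with r + s = n (and an index identification Fin n ≃ Fin r ⊕ Fin s), a unitary matrix Û ∈ 𝔻ℂ^{n×n}, matrices K ∈ 𝔻ℂ^{r×r}, L ∈ 𝔻ℂ^{r×s}, M ∈ 𝔻ℂ^{s×r}, N ∈ 𝔻ℂ^{s×s} such that the block matrix [K L; M N] is unitary, a diagonal matrix Σ₁ ∈ 𝔻ℂ^{r×r} whose diagonal entries are positive appreciable real dual numbers, and a diagonal matrix Σ₂ ∈ 𝔻ℂ^{s×s} whose diagonal entries are nonnegative infinitesimal real dual numbers, such that Â (reindexed along the identification) equals Û · fromBlocks(Σ₁K, Σ₁L, Σ₂M, Σ₂N) · Û*. -/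
open Matrix

/-- The dual complex numbers `𝔻ℂ := ℂ[ε]`, the trivial square-zero extension of `ℂ` by `ℂ`. -/
abbrev DC := TrivSqZeroExt ℂ ℂ

/-- Star on dual complex numbers: `(a + b·ε)* = conj a + conj b · ε`. -/
instance : Star DC :=
  ⟨fun x => ((starRingEnd ℂ) x.fst, (starRingEnd ℂ) x.snd)⟩

/-- A positive appreciable real dual number: the standard part is a positive real and
the dual part is real. -/
def PosAppreciable (x : DC) : Prop :=
  (∃ a : ℝ, 0 < a ∧ x.fst = (a : ℂ)) ∧ (∃ b : ℝ, x.snd = (b : ℂ))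

/-- A nonnegative infinitesimal real dual number: the standard part is `0` and
the dual part is a nonnegative real. -/
def NonnegInfinitesimal (x : DC) : Prop :=
  x.fst = 0 ∧ ∃ b : ℝ, 0 ≤ b ∧ x.snd = (b : ℂ)

/-- The standard part of a dual complex matrix. -/
def stdPart {m n : Type*} (X : Matrix m n DC) : Matrix m n ℂ :=
  X.map TrivSqZeroExt.fst

/-- The dual part of a dual complex matrix. -/
def dualPart {m n : Type*} (X : Matrix m n DC) : Matrix m n ℂ :=
  X.map TrivSqZeroExt.snd

/-- If `Cᴴ * C` is a real nonnegative diagonal matrix, then `C` is a unitary matrix times a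
nonnegative diagonal matrix. -/
theorem exists_unitary_mul_diagonal {n : Type*} [Fintype n] [DecidableEq n]
    (C : Matrix n n ℂ) (l : n → ℝ) (hC : Cᴴ * C = diagonal (fun i => (l i : ℂ))) :
    ∃ U ∈ unitaryGroup n ℂ, C = U * diagonal (fun i => (√(l i) : ℂ)) := by
  have hCij (i j : n) : ∑ k, star (C k i) * C k j = if i = j then (l i : ℂ) else 0 := by
    simpa [mul_apply, diagonal_apply] using congrFun (congrFun hC i) j
  have hnorm (i : n) : ∑ k, ‖C k i‖ ^ 2 = l i := by
    have h := hCij i i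
    rw [if_pos rfl] at h
    apply Complex.ofReal_injective
    rw [← h]
    push_cast
    refine Finset.sum_congr rfl fun k _ => ?_
    exact (RCLike.conj_mul (C k i)).symm
  have hl (i : n) : 0 ≤ l i := hnorm i ▸ Finset.sum_nonneg fun k _ => sq_nonneg _
  let v : n → EuclideanSpace ℂ n := fun i => WithLp.toLp 2 fun k => C k i / (√(l i) : ℂ)
  have hv : Orthonormal ℂ ({i | l i ≠ 0}.domRestrict v) := by
    rw [orthonormal_iff_ite]
    rintro ⟨i, hi⟩ ⟨j, hj⟩
    have : inner ℂ (v i) (v j) =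
        (∑ k, star (C k i) * C k j) / ((√(l i) : ℂ) * (√(l j) : ℂ)) := by
      simp only [v, PiLp.inner_apply, RCLike.inner_apply, map_div₀, Complex.conj_ofReal,
        Finset.sum_div]
      refine Finset.sum_congr rfl fun k _ => ?_
      rw [div_mul_div_comm, mul_comm (C k j), mul_comm (√(l j) : ℂ)]
      rfl
    simp only [Set.domRestrict_apply, this, hCij, Subtype.mk.injEq]
    split_ifs with h
    · subst h
      rw [← Complex.ofReal_mul, Real.mul_self_sqrt (hl i), div_self]
      exact_mod_cast hi
    · simp
  obtain ⟨b, hb⟩ := hv.exists_orthonormalBasis_extension_of_card_eq (by simp)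
  refine ⟨of fun k i => b i k, ?_, ?_⟩
  · rw [mem_unitaryGroup_iff']
    ext i j
    have h := orthonormal_iff_ite.mp b.orthonormal i j
    rw [PiLp.inner_apply] at h
    simp only [mul_apply, star_apply, of_apply, one_apply]
    rw [← h]
    refine Finset.sum_congr rfl fun k _ => ?_
    rw [RCLike.inner_apply, mul_comm]
    rfl
  · ext k i
    rw [mul_diagonal, of_apply]
    by_cases hi : l i = 0
    · have h := hnorm i
      rw [hi, Finset.sum_eq_zero_iff_of_nonneg fun k _ => sq_nonneg _] at h
      simpa [hi] using h k (Finset.mem_univ k)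
    · rw [hb i hi]
      have : (√(l i) : ℂ) ≠ 0 := by
        exact_mod_cast (Real.sqrt_ne_zero (hl i)).mpr hi
      simp [v, this]

/-- Spectral theorem for Hermitian complex matrices, as an existence statement. -/
theorem exists_unitary_diagonalization {n : Type*} [Fintype n] [DecidableEq n]
    {A : Matrix n n ℂ} (hA : A.IsHermitian) :
    ∃ U ∈ unitaryGroup n ℂ, ∃ l : n → ℝ, A = U * diagonal (fun i => (l i : ℂ)) * Uᴴ :=
  ⟨hA.eigenvectorUnitary, hA.eigenvectorUnitary.2, hA.eigenvalues, hA.spectral_theorem⟩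

/-- Singular value decomposition of a square complex matrix. -/
theorem exists_complex_svd {n : Type*} [Fintype n] [DecidableEq n] (A : Matrix n n ℂ) :
    ∃ U ∈ unitaryGroup n ℂ, ∃ V ∈ unitaryGroup n ℂ, ∃ d : n → ℝ, (∀ i, 0 ≤ d i) ∧
      A = U * diagonal (fun i => (d i : ℂ)) * Vᴴ := by
  obtain ⟨V, hV, l, hl⟩ := exists_unitary_diagonalization (isHermitian_conjTranspose_mul_self A)
  have hV₁ : Vᴴ * V = 1 := mem_unitaryGroup_iff'.mp hV
  have hV₂ : V * Vᴴ = 1 := mem_unitaryGroup_iff.mp hV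
  obtain ⟨U, hU, h⟩ := exists_unitary_mul_diagonal (A * V) l <| by
    rw [conjTranspose_mul, Matrix.mul_assoc, ← Matrix.mul_assoc Aᴴ, hl, Matrix.mul_assoc,
      Matrix.mul_assoc, hV₁, Matrix.mul_one, ← Matrix.mul_assoc, hV₁, Matrix.one_mul]
  refine ⟨U, hU, V, hV, fun i => √(l i), fun i => Real.sqrt_nonneg _, ?_⟩
  rw [← h, Matrix.mul_assoc, hV₂, Matrix.mul_one]

/-- A matrix which is supported on the level sets of `d`, and Hermitian on the nonzero level sets,
has a singular value decomposition compatible with `diagonal d`. -/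
theorem exists_svd_of_level_sets {n : Type*} [Fintype n] [DecidableEq n] (d : n → ℝ)
    (B : Matrix n n ℂ) (h₀ : ∀ i j, d i ≠ d j → B i j = 0)
    (h₁ : ∀ i j, d i = d j → d i ≠ 0 → star (B j i) = B i j) :
    ∃ X ∈ unitaryGroup n ℂ, ∃ Y ∈ unitaryGroup n ℂ, ∃ s : n → ℝ, (∀ i, d i = 0 → 0 ≤ s i) ∧
      X * diagonal (fun i => (d i : ℂ)) = diagonal (fun i => (d i : ℂ)) * Y ∧
      B = X * diagonal (fun i => (s i : ℂ)) * Yᴴ := by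
  classical
  let f := Set.rangeFactorization d
  have hf {i : n} {c : Set.range d} (h : f i = c) : d i = c := congrArg Subtype.val h
  have hblock (c : Set.range d) : ∃ X ∈ unitaryGroup {i // f i = c} ℂ,
      ∃ Y ∈ unitaryGroup {i // f i = c} ℂ, ∃ s : {i // f i = c} → ℝ,
      ((c : ℝ) = 0 → ∀ i, 0 ≤ s i) ∧ ((c : ℝ) ≠ 0 → X = Y) ∧
      B.submatrix (Subtype.val : {i // f i = c} → n) Subtype.val =
        X * diagonal (fun i => (s i : ℂ)) * Yᴴ := by
    by_cases hc : (c : ℝ) = 0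
    · obtain ⟨X, hX, Y, hY, s, hs, h⟩ :=
        exists_complex_svd (B.submatrix (Subtype.val : {i // f i = c} → n) Subtype.val)
      exact ⟨X, hX, Y, hY, s, fun _ => hs, fun h => absurd hc h, h⟩
    · have hH : (B.submatrix (Subtype.val : {i // f i = c} → n) Subtype.val).IsHermitian := by
        ext ⟨i, hi⟩ ⟨j, hj⟩
        exact h₁ i j ((hf hi).trans (hf hj).symm) (hf hi ▸ hc)
      obtain ⟨X, hX, s, h⟩ := exists_unitary_diagonalization hH
      exact ⟨X, hX, X, hX, s, fun h => absurd h hc, fun _ => rfl, h⟩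
  choose X hX Y hY s hs hXY hB using hblock
  let e := Equiv.sigmaFiberEquiv f
  have hunit (Z : ∀ c : Set.range d, Matrix {i // f i = c} {i // f i = c} ℂ)
      (hZ : ∀ c, Z c ∈ unitaryGroup {i // f i = c} ℂ) :
      (blockDiagonal' Z).submatrix e.symm e.symm ∈ unitaryGroup n ℂ := by
    rw [mem_unitaryGroup_iff, star_eq_conjTranspose, conjTranspose_submatrix,
      submatrix_mul_equiv, blockDiagonal'_conjTranspose, ← blockDiagonal'_mul]
    have : (fun c => Z c * (Z c)ᴴ) = 1 := funext fun c => mem_unitaryGroup_iff.mp (hZ c)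
    rw [this, blockDiagonal'_one, submatrix_one_equiv]
  have hdiag (t : n → ℝ) : diagonal (fun i => (t i : ℂ)) =
      (diagonal (fun x => (t (e x) : ℂ))).submatrix e.symm e.symm := by
    rw [submatrix_diagonal_equiv]
    simp [Function.comp_def]
  refine ⟨_, hunit X hX, _, hunit Y hY, fun i => s _ (e.symm i).2, ?_, ?_, ?_⟩
  · intro i hi
    exact hs _ hi _
  · rw [hdiag, submatrix_mul_equiv, submatrix_mul_equiv]
    congr 1
    ext ⟨c, i⟩ ⟨c', j⟩
    rw [mul_diagonal, diagonal_mul]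
    by_cases hcc : c = c'
    · subst hcc
      have hi : d (e ⟨c, i⟩) = c := hf i.2
      have hj : d (e ⟨c, j⟩) = c := hf j.2
      rw [blockDiagonal'_apply_eq, blockDiagonal'_apply_eq, hi, hj]
      by_cases hc : (c : ℝ) = 0
      · simp [hc]
      · rw [hXY c hc, mul_comm]
    · rw [blockDiagonal'_apply_ne _ _ _ hcc, blockDiagonal'_apply_ne _ _ _ hcc, zero_mul, mul_zero]
  · have hs' : (diagonal fun i => ((s _ (e.symm i).2 : ℝ) : ℂ)) =
        (blockDiagonal' fun c => diagonal fun i => (s c i : ℂ)).submatrix e.symm e.symm := by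
      rw [blockDiagonal'_diagonal, submatrix_diagonal_equiv]
      rfl
    rw [hs', conjTranspose_submatrix, submatrix_mul_equiv, submatrix_mul_equiv,
      blockDiagonal'_conjTranspose, ← blockDiagonal'_mul, ← blockDiagonal'_mul]
    simp_rw [← hB]
    ext i j
    obtain ⟨⟨c, i⟩, rfl⟩ := e.surjective i
    obtain ⟨⟨c', j⟩, rfl⟩ := e.surjective j
    rw [submatrix_apply, Equiv.symm_apply_apply, Equiv.symm_apply_apply]
    by_cases hcc : c = c'
    · subst hcc
      rw [blockDiagonal'_apply_eq]
      rfl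
    · rw [blockDiagonal'_apply_ne _ _ _ hcc]
      refine h₀ _ _ fun h => hcc (Subtype.ext ?_)
      exact (hf i.2).symm.trans (h.trans (hf j.2))

/-- First-order perturbation: any matrix `B` can be corrected by skew-Hermitian `P` and `Q` so that
`B - (P D - D Q)` is supported on the level sets of `D = diagonal d` and is Hermitian on the
nonzero ones. -/
theorem exists_skew_correction {n : Type*} [Fintype n] [DecidableEq n] (d : n → ℝ)
    (hd : ∀ i, 0 ≤ d i) (B : Matrix n n ℂ) :
    ∃ P Q B' : Matrix n n ℂ, Pᴴ = -P ∧ Qᴴ = -Q ∧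
      B = B' + P * diagonal (fun i => (d i : ℂ)) - diagonal (fun i => (d i : ℂ)) * Q ∧
      (∀ i j, d i ≠ d j → B' i j = 0) ∧
      (∀ i j, d i = d j → d i ≠ 0 → star (B' j i) = B' i j) := by
  have hsq {i j : n} (h : d i ≠ d j) : (d j : ℂ) ^ 2 - (d i : ℂ) ^ 2 ≠ 0 := by
    rw [sub_ne_zero]
    norm_cast
    exact fun h' => h ((sq_eq_sq₀ (hd _) (hd _)).mp h').symm
  let P : Matrix n n ℂ := of fun i j =>
    if d i = d j then (B i j - star (B j i)) / (2 * d i)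
    else (B i j * d j + d i * star (B j i)) / ((d j : ℂ) ^ 2 - (d i : ℂ) ^ 2)
  let Q : Matrix n n ℂ := of fun i j =>
    if d i = d j then 0
    else (d i * B i j + d j * star (B j i)) / ((d j : ℂ) ^ 2 - (d i : ℂ) ^ 2)
  let D : Matrix n n ℂ := diagonal fun i => (d i : ℂ)
  refine ⟨P, Q, B - P * D + D * Q, ?_, ?_, by simp only [D]; abel, ?_, ?_⟩
  · ext i j
    rw [conjTranspose_apply, neg_apply]
    simp only [P, of_apply, eq_comm (a := d j)]
    split_ifs with h
    · simp [h]
      ring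
    · have := hsq h
      have := hsq (Ne.symm h)
      simp
      field_simp
      ring
  · ext i j
    rw [conjTranspose_apply, neg_apply]
    simp only [Q, of_apply, eq_comm (a := d j)]
    split_ifs with h
    · simp
    · have := hsq h
      have := hsq (Ne.symm h)
      simp
      field_simp
      ring
  · intro i j h
    have := hsq h
    simp only [D, Matrix.add_apply, Matrix.sub_apply, mul_diagonal, diagonal_mul, P, Q, of_apply, if_neg h]
    field_simp
    ring
  · intro i j h hi
    have hj : (d j : ℂ) ≠ 0 := by exact_mod_cast h ▸ hi
    simp only [D, Matrix.add_apply, Matrix.sub_apply, mul_diagonal, diagonal_mul, P, Q, of_apply, h,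
      if_true]
    simp
    field_simp
    ring

/-- The dual complex matrix `X + Y ε`. -/
def dualMatrix {m n : Type*} (X Y : Matrix m n ℂ) : Matrix m n DC :=
  of fun i j => (TrivSqZeroExt.inl (X i j) + TrivSqZeroExt.inr (Y i j) : DC)

theorem dualMatrix_stdPart_dualPart {m n : Type*} (A : Matrix m n DC) :
    dualMatrix (stdPart A) (dualPart A) = A := by
  ext i j
  · simp [dualMatrix, stdPart]
  · simp [dualMatrix, dualPart]

theorem dualMatrix_mul {l m n : Type*} [Fintype m] (X Y : Matrix l m ℂ) (X' Y' : Matrix m n ℂ) :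
    dualMatrix X Y * dualMatrix X' Y' = dualMatrix (X * X') (X * Y' + Y * X') := by
  ext i j
  · simp [dualMatrix, mul_apply, TrivSqZeroExt.fst_sum]
  · simp [dualMatrix, mul_apply, TrivSqZeroExt.snd_sum, Finset.sum_add_distrib, mul_comm]

theorem dualMatrix_conjTranspose {m n : Type*} (X Y : Matrix m n ℂ) :
    (dualMatrix X Y)ᴴ = dualMatrix Xᴴ Yᴴ := by
  ext i j
  · change (starRingEnd ℂ) (dualMatrix X Y j i).fst = _
    simp [dualMatrix]
  · change (starRingEnd ℂ) (dualMatrix X Y j i).snd = _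
    simp [dualMatrix]

theorem dualMatrix_one_zero {n : Type*} [DecidableEq n] :
    dualMatrix (1 : Matrix n n ℂ) 0 = 1 := by
  ext i j <;> by_cases h : i = j <;> simp [dualMatrix, one_apply, h]

theorem dualMatrix_diagonal {n : Type*} [DecidableEq n] (d s : n → ℂ) :
    dualMatrix (diagonal d) (diagonal s) =
      diagonal fun i => (TrivSqZeroExt.inl (d i) + TrivSqZeroExt.inr (s i) : DC) := by
  ext i j <;> by_cases h : i = j <;> simp [dualMatrix, diagonal_apply, h]

theorem dual_conjTranspose_mul {l m n : Type*} [Fintype m] (X : Matrix l m DC)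
    (Y : Matrix m n DC) : (X * Y)ᴴ = Yᴴ * Xᴴ := by
  rw [← dualMatrix_stdPart_dualPart X, ← dualMatrix_stdPart_dualPart Y]
  simp only [dualMatrix_mul, dualMatrix_conjTranspose, conjTranspose_add, conjTranspose_mul]
  rw [add_comm]

theorem dual_conjTranspose_conjTranspose {m n : Type*} (X : Matrix m n DC) : Xᴴᴴ = X := by
  rw [← dualMatrix_stdPart_dualPart X]
  simp only [dualMatrix_conjTranspose, conjTranspose_conjTranspose]

/-- Singular value decomposition of a square dual complex matrix. -/
theorem exists_dual_svd {n : Type*} [Fintype n] [DecidableEq n] (A : Matrix n n DC) :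
    ∃ (U V : Matrix n n DC) (d : n → DC), U * Uᴴ = 1 ∧ Uᴴ * U = 1 ∧ V * Vᴴ = 1 ∧ Vᴴ * V = 1 ∧
      (∀ i, PosAppreciable (d i) ∨ NonnegInfinitesimal (d i)) ∧ A = U * diagonal d * Vᴴ := by
  obtain ⟨U, hU, V, hV, d, hd, hA⟩ := exists_complex_svd (stdPart A)
  obtain ⟨P, Q, B, hP, hQ, hB, hB₀, hB₁⟩ :=
    exists_skew_correction d hd (Uᴴ * dualPart A * V)
  obtain ⟨X, hX, Y, hY, s, hs, hXY, hBs⟩ := exists_svd_of_level_sets d B hB₀ hB₁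
  rw [mem_unitaryGroup_iff, star_eq_conjTranspose] at hU hV hX hY
  set D : Matrix n n ℂ := diagonal fun i => (d i : ℂ) with hD
  set S : Matrix n n ℂ := diagonal fun i => (s i : ℂ) with hS
  have hunit {Z R : Matrix n n ℂ} (hZ : Z * Zᴴ = 1) (hR : Rᴴ = -R) (W : Matrix n n ℂ)
      (hW : W * Wᴴ = 1) :
      dualMatrix (Z * W) (Z * R * W) * (dualMatrix (Z * W) (Z * R * W))ᴴ = 1 := by
    rw [dualMatrix_conjTranspose, dualMatrix_mul, ← dualMatrix_one_zero]
    congr 1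
    · rw [conjTranspose_mul, Matrix.mul_assoc, ← Matrix.mul_assoc W, hW, Matrix.one_mul, hZ]
    · simp only [conjTranspose_mul, hR, Matrix.mul_assoc]
      simp only [← Matrix.mul_assoc W, hW, Matrix.one_mul]
      simp
  have hU' := hunit hU hP X hX
  have hV' := hunit hV hQ Y hY
  refine ⟨_, _, fun i => TrivSqZeroExt.inl (d i : ℂ) + TrivSqZeroExt.inr (s i : ℂ), hU',
    mul_eq_one_comm.mp hU', hV', mul_eq_one_comm.mp hV', ?_, ?_⟩
  · intro i
    simp only [PosAppreciable, NonnegInfinitesimal, TrivSqZeroExt.fst_add, TrivSqZeroExt.fst_inl,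
      TrivSqZeroExt.fst_inr, TrivSqZeroExt.snd_add, TrivSqZeroExt.snd_inl, TrivSqZeroExt.snd_inr,
      add_zero, zero_add]
    rcases (hd i).eq_or_lt with h | h
    · exact Or.inr ⟨by simp [← h], s i, hs i h.symm, rfl⟩
    · exact Or.inl ⟨⟨d i, h, rfl⟩, s i, rfl⟩
  · have hDY : X * D * Yᴴ = D := by rw [hXY, Matrix.mul_assoc, hY, Matrix.mul_one]
    have hA₁ : dualPart A = U * (B + P * D - D * Q) * Vᴴ := by
      rw [← hB]
      simp only [Matrix.mul_assoc]
      rw [hV, Matrix.mul_one, ← Matrix.mul_assoc, hU, Matrix.one_mul]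
    rw [← dualMatrix_diagonal, ← hD, ← hS, dualMatrix_conjTranspose, dualMatrix_mul,
      dualMatrix_mul]
    conv_lhs => rw [← dualMatrix_stdPart_dualPart A]
    congr 1
    · rw [hA]
      nth_rw 1 [← hDY]
      simp only [conjTranspose_mul, Matrix.mul_assoc]
    · rw [hA₁, hBs]
      nth_rw 1 [← hDY]
      nth_rw 2 [← hDY]
      simp only [conjTranspose_mul, hQ, Matrix.mul_add, Matrix.add_mul, Matrix.mul_sub,
        Matrix.sub_mul, Matrix.mul_assoc, Matrix.mul_neg, Matrix.neg_mul]
      abel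

/-- Hartwig–Spindelböck decomposition of a dual complex matrix. -/
theorem hartwig_spindelboeck_decomposition (n : ℕ) (A : Matrix (Fin n) (Fin n) DC) :
    ∃ (r s : ℕ), r + s = n ∧
      ∃ (e : Fin n ≃ (Fin r ⊕ Fin s))
        (U : Matrix (Fin r ⊕ Fin s) (Fin r ⊕ Fin s) DC)
        (K : Matrix (Fin r) (Fin r) DC) (L : Matrix (Fin r) (Fin s) DC)
        (M : Matrix (Fin s) (Fin r) DC) (N : Matrix (Fin s) (Fin s) DC)
        (d₁ : Fin r → DC) (d₂ : Fin s → DC),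
        U * Uᴴ = 1 ∧ Uᴴ * U = 1 ∧
        fromBlocks K L M N * (fromBlocks K L M N)ᴴ = 1 ∧
        (fromBlocks K L M N)ᴴ * fromBlocks K L M N = 1 ∧
        (∀ i, PosAppreciable (d₁ i)) ∧
        (∀ i, NonnegInfinitesimal (d₂ i)) ∧
        A.submatrix e.symm e.symm =
          U * fromBlocks (Matrix.diagonal d₁ * K) (Matrix.diagonal d₁ * L)
            (Matrix.diagonal d₂ * M) (Matrix.diagonal d₂ * N) * Uᴴ := by
  classical
  obtain ⟨U, V, d, hU₁, hU₂, hV₁, hV₂, hd, hA⟩ := exists_dual_svd A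
  let p : Fin n → Prop := fun i => PosAppreciable (d i)
  let e : Fin n ≃ Fin (Fintype.card {i // p i}) ⊕ Fin (Fintype.card {i // ¬ p i}) :=
    (Equiv.sumCompl p).symm.trans
      (Equiv.sumCongr (Fintype.equivFin {i // p i}) (Fintype.equivFin {i // ¬ p i}))
  let W := (Vᴴ * U).submatrix e.symm e.symm
  have hWW : W * Wᴴ = 1 := by
    rw [conjTranspose_submatrix, submatrix_mul_equiv, dual_conjTranspose_mul,
      dual_conjTranspose_conjTranspose, Matrix.mul_assoc, ← Matrix.mul_assoc U, hU₁,
      Matrix.one_mul, hV₂, submatrix_one_equiv]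
  have hUU : U.submatrix e.symm e.symm * (U.submatrix e.symm e.symm)ᴴ = 1 := by
    rw [conjTranspose_submatrix, submatrix_mul_equiv, hU₁, submatrix_one_equiv]
  refine ⟨_, _, ?_, e, U.submatrix e.symm e.symm, W.toBlocks₁₁, W.toBlocks₁₂, W.toBlocks₂₁,
    W.toBlocks₂₂, fun i => d (e.symm (Sum.inl i)), fun i => d (e.symm (Sum.inr i)), hUU,
    mul_eq_one_comm.mp hUU, ?_, ?_, fun i => ?_, fun i => ?_, ?_⟩
  · simpa using (Fintype.card_congr e).symm
  · rwa [fromBlocks_toBlocks]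
  · rw [fromBlocks_toBlocks]
    exact mul_eq_one_comm.mp hWW
  · exact ((Fintype.equivFin {i // p i}).symm i).2
  · exact (hd _).resolve_left ((Fintype.equivFin {i // ¬ p i}).symm i).2
  · have hfac : fromBlocks (diagonal (fun i => d (e.symm (Sum.inl i))) * W.toBlocks₁₁)
        (diagonal (fun i => d (e.symm (Sum.inl i))) * W.toBlocks₁₂)
        (diagonal (fun i => d (e.symm (Sum.inr i))) * W.toBlocks₂₁)
        (diagonal (fun i => d (e.symm (Sum.inr i))) * W.toBlocks₂₂) =
        (diagonal d).submatrix e.symm e.symm * W := by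
      conv_rhs => rw [← fromBlocks_toBlocks W, submatrix_diagonal_equiv]
      rw [show d ∘ e.symm = Sum.elim (fun i => d (e.symm (Sum.inl i)))
        (fun i => d (e.symm (Sum.inr i))) by ext (i | i) <;> rfl, ← fromBlocks_diagonal,
        fromBlocks_multiply]
      simp
    rw [hfac, conjTranspose_submatrix, submatrix_mul_equiv, submatrix_mul_equiv,
      submatrix_mul_equiv]
    congr 1
    rw [hA]
    simp only [Matrix.mul_assoc]
    rw [hU₁, Matrix.mul_one]
end

section
/- Representation of the new dual Moore–Penrose inverse via the Hartwig–Spindelböck decomposition: with the decomposition data as in the context, the matrix X := Û · fromBlocks(K*Σ₁⁻¹, 0, L*Σ₁⁻¹, 0) · Û* satisfies the four NDMPI equations with respect to Â and its essential part A_e := Û · fromBlocks(Σ₁K, Σ₁L, 0, 0) · Û*, namely: Â·X·Â = A_e, X·Â·X = X, (Â·X)* = Â·X, and (X·Â)* = X·Â. -/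
open Matrix

/-- The entrywise conjugation makes the dual complex numbers a star ring. -/
instance : StarRing DC where
  star_involutive x := by
    apply TrivSqZeroExt.ext
    · exact Complex.conj_conj x.fst
    · exact Complex.conj_conj x.snd
  star_mul x y := by
    apply TrivSqZeroExt.ext
    · exact (map_mul (starRingEnd ℂ) x.fst y.fst).trans (mul_comm _ _)
    · change (starRingEnd ℂ) (x.fst * y.snd + x.snd * y.fst) =
        (starRingEnd ℂ) y.fst * (starRingEnd ℂ) x.snd +
          (starRingEnd ℂ) y.snd * (starRingEnd ℂ) x.fst
      rw [map_add, map_mul, map_mul]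
      ring
  star_add x y := by
    apply TrivSqZeroExt.ext
    · exact map_add (starRingEnd ℂ) x.fst y.fst
    · exact map_add (starRingEnd ℂ) x.snd y.snd

lemma PosAppreciable.isUnit {x : DC} (hx : PosAppreciable x) : IsUnit x := by
  obtain ⟨⟨a, ha, hxa⟩, -⟩ := hx
  rw [TrivSqZeroExt.isUnit_iff_isUnit_fst, hxa, isUnit_iff_ne_zero]
  exact_mod_cast ha.ne'

lemma Matrix.isUnit_det_diagonal {n R : Type*} [Fintype n] [DecidableEq n] [CommRing R]
    {d : n → R} (hd : ∀ i, IsUnit (d i)) : IsUnit (Matrix.diagonal d).det := by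
  rw [Matrix.det_diagonal, IsUnit.prod_univ_iff]
  exact hd

/-- Conjugations by a matrix with orthonormal columns compose. -/
lemma Matrix.conj_mul_conj {n R : Type*} [Fintype n] [DecidableEq n] [Semiring R] [Star R]
    {U : Matrix n n R} (hU : Uᴴ * U = 1) (X Y : Matrix n n R) :
    U * X * Uᴴ * (U * Y * Uᴴ) = U * (X * Y) * Uᴴ := by
  calc U * X * Uᴴ * (U * Y * Uᴴ) = U * X * (Uᴴ * U) * Y * Uᴴ := by
        simp only [Matrix.mul_assoc]
    _ = U * (X * Y) * Uᴴ := by rw [hU, Matrix.mul_one, Matrix.mul_assoc U X Y]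

/-- The NDMPI of a dual complex matrix via the Hartwig–Spindelböck decomposition. -/
theorem ndmpi_of_hartwig_spindelboeck
    {r s : ℕ}
    -- `Û`, a unitary matrix
    (U : Matrix (Fin r ⊕ Fin s) (Fin r ⊕ Fin s) DC)
    (hU₁ : U * Uᴴ = 1) (hU₂ : Uᴴ * U = 1)
    -- the blocks `K, L, M, N` forming a unitary block matrix
    (K : Matrix (Fin r) (Fin r) DC) (L : Matrix (Fin r) (Fin s) DC)
    (M : Matrix (Fin s) (Fin r) DC) (N : Matrix (Fin s) (Fin s) DC)
    (hW₁ : fromBlocks K L M N * (fromBlocks K L M N)ᴴ = 1)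
    (hW₂ : (fromBlocks K L M N)ᴴ * fromBlocks K L M N = 1)
    -- `Σ₁` diagonal with positive appreciable real dual diagonal entries
    (S₁ : Matrix (Fin r) (Fin r) DC) (d₁ : Fin r → DC)
    (hS₁ : S₁ = Matrix.diagonal d₁) (hd₁ : ∀ i, PosAppreciable (d₁ i))
    -- `Σ₂` diagonal with nonnegative infinitesimal real dual diagonal entries
    (S₂ : Matrix (Fin s) (Fin s) DC) (d₂ : Fin s → DC)
    (hS₂ : S₂ = Matrix.diagonal d₂) (hd₂ : ∀ i, NonnegInfinitesimal (d₂ i))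
    -- the Hartwig–Spindelböck decomposition of `Â`
    (A : Matrix (Fin r ⊕ Fin s) (Fin r ⊕ Fin s) DC)
    (hA : A = U * fromBlocks (S₁ * K) (S₁ * L) (S₂ * M) (S₂ * N) * Uᴴ)
    -- `A_e`, the essential part of `Â`
    (Ae : Matrix (Fin r ⊕ Fin s) (Fin r ⊕ Fin s) DC)
    (hAe : Ae = U * fromBlocks (S₁ * K) (S₁ * L) 0 0 * Uᴴ)
    -- `Â^N`, the NDMPI of `Â`
    (AN : Matrix (Fin r ⊕ Fin s) (Fin r ⊕ Fin s) DC)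
    (hAN : AN = U * fromBlocks (Kᴴ * S₁⁻¹) 0 (Lᴴ * S₁⁻¹) 0 * Uᴴ) :
    A * AN * A = Ae ∧ AN * A * AN = AN ∧ (A * AN)ᴴ = A * AN ∧ (AN * A)ᴴ = AN * A := by
  have hdet : IsUnit S₁.det := by
    rw [hS₁]
    exact Matrix.isUnit_det_diagonal fun i => (hd₁ i).isUnit
  have hW := hW₁
  rw [fromBlocks_conjTranspose, fromBlocks_multiply, ← fromBlocks_one, fromBlocks_inj] at hW
  obtain ⟨hKL, -, hMN, -⟩ := hW
  have hP : A * AN = U * fromBlocks 1 0 0 0 * Uᴴ := by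
    have h₁ : S₁ * K * (Kᴴ * S₁⁻¹) + S₁ * L * (Lᴴ * S₁⁻¹) = 1 := by
      calc S₁ * K * (Kᴴ * S₁⁻¹) + S₁ * L * (Lᴴ * S₁⁻¹)
          = S₁ * (K * Kᴴ + L * Lᴴ) * S₁⁻¹ := by
            simp only [Matrix.mul_add, Matrix.add_mul, Matrix.mul_assoc]
        _ = 1 := by rw [hKL, Matrix.mul_one, Matrix.mul_nonsing_inv _ hdet]
    have h₂ : S₂ * M * (Kᴴ * S₁⁻¹) + S₂ * N * (Lᴴ * S₁⁻¹) = 0 := by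
      calc S₂ * M * (Kᴴ * S₁⁻¹) + S₂ * N * (Lᴴ * S₁⁻¹)
          = S₂ * (M * Kᴴ + N * Lᴴ) * S₁⁻¹ := by
            simp only [Matrix.mul_add, Matrix.add_mul, Matrix.mul_assoc]
        _ = 0 := by rw [hMN, Matrix.mul_zero, Matrix.zero_mul]
    rw [hA, hAN, Matrix.conj_mul_conj hU₂, fromBlocks_multiply, h₁, h₂]
    simp only [Matrix.mul_zero, add_zero]
  have hQ : AN * A = U * fromBlocks (Kᴴ * K) (Kᴴ * L) (Lᴴ * K) (Lᴴ * L) * Uᴴ := by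
    have h : ∀ {p q : ℕ} (X : Matrix (Fin p) (Fin r) DC) (Y : Matrix (Fin r) (Fin q) DC),
        X * S₁⁻¹ * (S₁ * Y) = X * Y := fun X Y => by
      rw [Matrix.mul_assoc, Matrix.nonsing_inv_mul_cancel_left _ _ hdet]
    rw [hA, hAN, Matrix.conj_mul_conj hU₂, fromBlocks_multiply]
    simp only [h, Matrix.zero_mul, add_zero]
  refine ⟨?_, ?_, ?_, ?_⟩
  · rw [hP, hA, hAe, Matrix.conj_mul_conj hU₂, fromBlocks_multiply]
    simp only [Matrix.one_mul, Matrix.zero_mul, add_zero]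
  · rw [Matrix.mul_assoc, hP, hAN, Matrix.conj_mul_conj hU₂, fromBlocks_multiply]
    simp only [Matrix.mul_one, Matrix.mul_zero, add_zero]
  · rw [hP]
    simp only [conjTranspose_mul, conjTranspose_conjTranspose, fromBlocks_conjTranspose,
      conjTranspose_one, conjTranspose_zero, Matrix.mul_assoc]
  · rw [hQ]
    simp only [conjTranspose_mul, conjTranspose_conjTranspose, fromBlocks_conjTranspose,
      Matrix.mul_assoc]
end

section
/- Characterization of Hermitian dual complex matrices: with the Hartwig–Spindelböck decomposition data as in the context, Â is Hermitian (Â* = Â) if and only if K*Σ₁ = Σ₁K, (N_s)*·Σ₂d = Σ₂d·N_s, the standard part L_s of L is zero, and the dual part of L equals (Σ₁s)⁻¹·(M_s)*·Σ₂d, where X_s and X_d denote the entrywise standard and dual parts of a matrix X, Σ₁s is the (invertible) standard part of Σ₁, and Σ₂d is the dual part of Σ₂. -/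
open Matrix

instance inst_s3 : StarRing DC where
  star_involutive x := by
    apply TrivSqZeroExt.ext <;> exact Complex.conj_conj _
  star_mul x y := by
    apply TrivSqZeroExt.ext
    · change (starRingEnd ℂ) (x * y).fst = (starRingEnd ℂ) y.fst * (starRingEnd ℂ) x.fst
      simp [mul_comm]
    · change (starRingEnd ℂ) (x * y).snd = (star y * star x).snd
      rw [TrivSqZeroExt.snd_mul, TrivSqZeroExt.snd_mul, map_add, add_comm]
      simp only [smul_eq_mul, MulOpposite.smul_eq_mul_unop, MulOpposite.unop_op, map_mul]
      exact congrArg₂ (· + ·) (mul_comm _ _) (mul_comm _ _)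
  star_add x y := by
    apply TrivSqZeroExt.ext <;> exact map_add (starRingEnd ℂ) _ _

section DualMatrix

variable {l m n : Type*}

theorem matrix_eq_iff_stdPart_dualPart {X Y : Matrix m n DC} :
    X = Y ↔ stdPart X = stdPart Y ∧ dualPart X = dualPart Y := by
  refine ⟨fun h => h ▸ ⟨rfl, rfl⟩, fun h => ?_⟩
  ext i j
  · exact congrFun (congrFun h.1 i) j
  · exact congrFun (congrFun h.2 i) j

theorem stdPart_mul [Fintype m] (X : Matrix l m DC) (Y : Matrix m n DC) :
    stdPart (X * Y) = stdPart X * stdPart Y := by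
  ext i j
  simp [stdPart, Matrix.mul_apply, TrivSqZeroExt.fst_sum]

theorem dualPart_mul [Fintype m] (X : Matrix l m DC) (Y : Matrix m n DC) :
    dualPart (X * Y) = stdPart X * dualPart Y + dualPart X * stdPart Y := by
  ext i j
  simp [stdPart, dualPart, Matrix.mul_apply, TrivSqZeroExt.snd_sum, Finset.sum_add_distrib,
    mul_comm]

theorem stdPart_conjTranspose (X : Matrix m n DC) : stdPart Xᴴ = (stdPart X)ᴴ := rfl

theorem dualPart_conjTranspose (X : Matrix m n DC) : dualPart Xᴴ = (dualPart X)ᴴ := rfl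

end DualMatrix

theorem PosAppreciable.star_eq {x : DC} (hx : PosAppreciable x) : star x = x := by
  obtain ⟨⟨a, -, ha⟩, b, hb⟩ := hx
  apply TrivSqZeroExt.ext
  · change (starRingEnd ℂ) x.fst = x.fst
    rw [ha, Complex.conj_ofReal]
  · change (starRingEnd ℂ) x.snd = x.snd
    rw [hb, Complex.conj_ofReal]

theorem NonnegInfinitesimal.star_eq {x : DC} (hx : NonnegInfinitesimal x) : star x = x := by
  obtain ⟨ha, b, -, hb⟩ := hx
  apply TrivSqZeroExt.ext
  · change (starRingEnd ℂ) x.fst = x.fst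
    rw [ha, map_zero]
  · change (starRingEnd ℂ) x.snd = x.snd
    rw [hb, Complex.conj_ofReal]

/-- Conjugation by a unitary matrix preserves and reflects Hermitian matrices. -/
theorem conjTranspose_unitary_conj_eq_iff {R n : Type*} [Fintype n] [DecidableEq n]
    [Semiring R] [StarRing R] {U : Matrix n n R} (hU : Uᴴ * U = 1) (B : Matrix n n R) :
    (U * B * Uᴴ)ᴴ = U * B * Uᴴ ↔ Bᴴ = B := by
  have key (C : Matrix n n R) : Uᴴ * (U * C * Uᴴ) * U = C := by
    rw [Matrix.mul_assoc U, ← Matrix.mul_assoc Uᴴ, hU, Matrix.one_mul, Matrix.mul_assoc, hU,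
      Matrix.mul_one]
  have hstar : (U * B * Uᴴ)ᴴ = U * Bᴴ * Uᴴ := by
    simp [Matrix.conjTranspose_mul, Matrix.mul_assoc]
  rw [hstar]
  refine ⟨fun h => ?_, fun h => by rw [h]⟩
  rw [← key Bᴴ, h, key]

/-- Characterization of Hermitian dual complex matrices. -/
theorem hermitian_iff
    {r s : ℕ}
    -- `Û`, a unitary matrix
    (U : Matrix (Fin r ⊕ Fin s) (Fin r ⊕ Fin s) DC)
    (hU₁ : U * Uᴴ = 1) (hU₂ : Uᴴ * U = 1)
    -- the blocks `K, L, M, N` forming a unitary block matrix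
    (K : Matrix (Fin r) (Fin r) DC) (L : Matrix (Fin r) (Fin s) DC)
    (M : Matrix (Fin s) (Fin r) DC) (N : Matrix (Fin s) (Fin s) DC)
    (hW₁ : fromBlocks K L M N * (fromBlocks K L M N)ᴴ = 1)
    (hW₂ : (fromBlocks K L M N)ᴴ * fromBlocks K L M N = 1)
    -- `Σ₁` diagonal with positive appreciable real dual diagonal entries
    (S₁ : Matrix (Fin r) (Fin r) DC) (d₁ : Fin r → DC)
    (hS₁ : S₁ = Matrix.diagonal d₁) (hd₁ : ∀ i, PosAppreciable (d₁ i))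
    -- `Σ₂` diagonal with nonnegative infinitesimal real dual diagonal entries
    (S₂ : Matrix (Fin s) (Fin s) DC) (d₂ : Fin s → DC)
    (hS₂ : S₂ = Matrix.diagonal d₂) (hd₂ : ∀ i, NonnegInfinitesimal (d₂ i))
    -- the Hartwig–Spindelböck decomposition of `Â`
    (A : Matrix (Fin r ⊕ Fin s) (Fin r ⊕ Fin s) DC)
    (hA : A = U * fromBlocks (S₁ * K) (S₁ * L) (S₂ * M) (S₂ * N) * Uᴴ) :
    Aᴴ = A ↔
      Kᴴ * S₁ = S₁ * K ∧
      (stdPart N)ᴴ * dualPart S₂ = dualPart S₂ * stdPart N ∧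
      stdPart L = 0 ∧
      dualPart L = (stdPart S₁)⁻¹ * (stdPart M)ᴴ * dualPart S₂ := by
  have hS₁_star : S₁ᴴ = S₁ := by
    rw [hS₁, Matrix.diagonal_conjTranspose]
    exact congrArg _ (funext fun i => (hd₁ i).star_eq)
  have hS₂_star : S₂ᴴ = S₂ := by
    rw [hS₂, Matrix.diagonal_conjTranspose]
    exact congrArg _ (funext fun i => (hd₂ i).star_eq)
  have hS₂_std : stdPart S₂ = 0 := by
    rw [hS₂, stdPart, Matrix.diagonal_map TrivSqZeroExt.fst_zero, ← Matrix.diagonal_zero]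
    exact congrArg _ (funext fun i => (hd₂ i).1)
  have hS₁_unit : IsUnit (stdPart S₁).det := by
    rw [hS₁, stdPart, Matrix.diagonal_map TrivSqZeroExt.fst_zero, Matrix.det_diagonal,
      isUnit_iff_ne_zero, Finset.prod_ne_zero_iff]
    intro i _
    obtain ⟨⟨a, ha, h⟩, -⟩ := hd₁ i
    simpa [h] using ha.ne'
  have hN : Nᴴ * S₂ = S₂ * N ↔
      (stdPart N)ᴴ * dualPart S₂ = dualPart S₂ * stdPart N := by
    simp [matrix_eq_iff_stdPart_dualPart, stdPart_mul, dualPart_mul, stdPart_conjTranspose,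
      hS₂_std]
  have hL : Mᴴ * S₂ = S₁ * L ↔
      stdPart L = 0 ∧ dualPart L = (stdPart S₁)⁻¹ * (stdPart M)ᴴ * dualPart S₂ := by
    simp only [matrix_eq_iff_stdPart_dualPart, stdPart_mul, dualPart_mul, stdPart_conjTranspose,
      hS₂_std, Matrix.mul_zero, add_zero]
    constructor
    · rintro ⟨h₁, h₂⟩
      have hL₀ : stdPart L = 0 := by
        rw [← Matrix.nonsing_inv_mul_cancel_left _ (stdPart L) hS₁_unit, ← h₁, Matrix.mul_zero]
      rw [hL₀, Matrix.mul_zero, add_zero] at h₂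
      exact ⟨hL₀, by rw [Matrix.mul_assoc, h₂, Matrix.nonsing_inv_mul_cancel_left _ _ hS₁_unit]⟩
    · rintro ⟨h₁, h₂⟩
      rw [h₁, h₂, Matrix.mul_assoc, Matrix.mul_nonsing_inv_cancel_left _ _ hS₁_unit]
      simp
  have hLM : Lᴴ * S₁ = S₂ * M ↔ Mᴴ * S₂ = S₁ * L := by
    rw [← Matrix.conjTranspose_inj, Matrix.conjTranspose_mul, Matrix.conjTranspose_mul,
      Matrix.conjTranspose_conjTranspose, hS₁_star, hS₂_star, eq_comm]
  rw [hA, conjTranspose_unitary_conj_eq_iff hU₂, Matrix.fromBlocks_conjTranspose,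
    Matrix.fromBlocks_inj]
  simp only [Matrix.conjTranspose_mul, hS₁_star, hS₂_star]
  rw [hLM, hN, hL]
  tauto
end

section
/- Characterization of normal dual complex matrices: with the Hartwig–Spindelböck decomposition data as in the context, Â is normal (Â·Â* = Â*·Â) if and only if L = 0 and Σ₁·K = K·Σ₁. -/
open Matrix

/-- Conjugating by a unitary element does not affect normality. -/
theorem mul_star_comm_conj_iff {R : Type*} [Ring R] [StarRing R] {U : R} (hU : star U * U = 1)
    (B : R) :
    U * B * star U * star (U * B * star U) = star (U * B * star U) * (U * B * star U) ↔
      B * star B = star B * B := by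
  have cancel (X Y : R) : U * X * star U * (U * Y * star U) = U * (X * Y) * star U := by
    calc U * X * star U * (U * Y * star U) = U * X * (star U * U) * Y * star U := by noncomm_ring
      _ = U * (X * Y) * star U := by rw [hU]; noncomm_ring
  have recover (X : R) : star U * (U * X * star U) * U = X := by
    calc star U * (U * X * star U) * U = (star U * U) * X * (star U * U) := by noncomm_ring
      _ = X := by rw [hU]; simp
  have hs : star (U * B * star U) = U * star B * star U := by simp [mul_assoc]
  rw [hs, cancel, cancel]
  refine ⟨fun h => ?_, fun h => by rw [h]⟩
  rw [← recover (B * star B), h, recover]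

/-- If `D` is self-adjoint and `W` unitary, then `D * W` is normal iff `W` commutes with `D ^ 2`. -/
theorem mul_star_comm_selfAdjoint_mul_unitary_iff {R : Type*} [Ring R] [StarRing R] {D W : R}
    (hD : star D = D) (hW₁ : W * star W = 1) (hW₂ : star W * W = 1) :
    D * W * star (D * W) = star (D * W) * (D * W) ↔ D * D * W = W * (D * D) := by
  have h₁ : D * W * star (D * W) = D * D := by
    calc D * W * star (D * W) = D * (W * star W) * D := by rw [star_mul, hD]; noncomm_ring
      _ = D * D := by rw [hW₁]; simp
  have h₂ : star (D * W) * (D * W) = star W * (D * D * W) := by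
    rw [star_mul, hD]; noncomm_ring
  rw [h₁, h₂]
  constructor
  · intro h
    have hW := congrArg (W * ·) h
    simp only [← mul_assoc W, hW₁, one_mul] at hW
    rw [← hW, mul_assoc]
  · intro h
    rw [h, ← mul_assoc, hW₂, one_mul]

/-- If all sums `d i + d j` are units, then commuting with `diagonal d` is the same as commuting
with its square. -/
theorem diagonal_sq_comm_iff {R n : Type*} [CommRing R] [Fintype n] [DecidableEq n] {d : n → R}
    (hd : ∀ i j, IsUnit (d i + d j)) (K : Matrix n n R) :
    diagonal d * diagonal d * K = K * (diagonal d * diagonal d) ↔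
      diagonal d * K = K * diagonal d := by
  constructor
  · intro h
    ext i j
    have hij := congrFun (congrFun h i) j
    simp only [diagonal_mul_diagonal, diagonal_mul, mul_diagonal] at hij ⊢
    exact (hd i j).mul_left_cancel (by linear_combination hij)
  · intro h
    rw [Matrix.mul_assoc, h, ← Matrix.mul_assoc, h, Matrix.mul_assoc]

/-- Normality criterion for a matrix with a Hartwig–Spindelböck decomposition over a commutative
star ring, when the lower singular block squares to zero. -/
theorem hartwigSpindelbock_normal_iff {R m n : Type*} [CommRing R] [StarRing R]
    [Fintype m] [DecidableEq m] [Fintype n] [DecidableEq n]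
    {U : Matrix (m ⊕ n) (m ⊕ n) R} (hU : Uᴴ * U = 1)
    {K : Matrix m m R} {L : Matrix m n R} {M : Matrix n m R} {N : Matrix n n R}
    (hW₁ : fromBlocks K L M N * (fromBlocks K L M N)ᴴ = 1)
    (hW₂ : (fromBlocks K L M N)ᴴ * fromBlocks K L M N = 1)
    {d₁ : m → R} (hs₁ : ∀ i, star (d₁ i) = d₁ i) (hd₁ : ∀ i j, IsUnit (d₁ i + d₁ j))
    {d₂ : n → R} (hs₂ : ∀ i, star (d₂ i) = d₂ i) (hd₂ : ∀ i, d₂ i * d₂ i = 0)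
    {A : Matrix (m ⊕ n) (m ⊕ n) R}
    (hA : A = U * fromBlocks (diagonal d₁ * K) (diagonal d₁ * L)
      (diagonal d₂ * M) (diagonal d₂ * N) * Uᴴ) :
    A * Aᴴ = Aᴴ * A ↔ L = 0 ∧ diagonal d₁ * K = K * diagonal d₁ := by
  have hB : fromBlocks (diagonal d₁ * K) (diagonal d₁ * L) (diagonal d₂ * M) (diagonal d₂ * N) =
      fromBlocks (diagonal d₁) 0 0 (diagonal d₂) * fromBlocks K L M N := by
    rw [fromBlocks_multiply]
    simp
  have hD : (fromBlocks (diagonal d₁) 0 0 (diagonal d₂))ᴴ =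
      fromBlocks (diagonal d₁) 0 0 (diagonal d₂) := by
    rw [fromBlocks_conjTranspose, diagonal_conjTranspose, diagonal_conjTranspose,
      show star d₁ = d₁ from funext hs₁, show star d₂ = d₂ from funext hs₂]
    simp
  have hsq : fromBlocks (diagonal d₁) 0 0 (diagonal d₂) *
      fromBlocks (diagonal d₁) 0 0 (diagonal d₂) =
      fromBlocks (diagonal d₁ * diagonal d₁) (0 : Matrix m n R) 0 0 := by
    rw [fromBlocks_multiply, diagonal_mul_diagonal d₂, funext hd₂]
    simp
  have hunit (i : m) : IsUnit (d₁ i) := by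
    have h := hd₁ i i
    rw [← two_mul] at h
    exact isUnit_of_mul_isUnit_right h
  simp only [← star_eq_conjTranspose] at hA hU hW₁ hW₂ hD ⊢
  rw [hA, mul_star_comm_conj_iff hU, hB, mul_star_comm_selfAdjoint_mul_unitary_iff hD hW₁ hW₂,
    hsq, fromBlocks_multiply, fromBlocks_multiply, fromBlocks_inj]
  simp only [Matrix.zero_mul, Matrix.mul_zero, add_zero]
  rw [diagonal_sq_comm_iff hd₁]
  constructor
  · rintro ⟨hK, hL, -, -⟩
    refine ⟨?_, hK⟩
    ext i j
    have hij := congrFun (congrFun hL i) j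
    simp only [diagonal_mul_diagonal, diagonal_mul, Matrix.zero_apply] at hij ⊢
    exact ((hunit i).mul (hunit i)).mul_left_cancel (by rw [hij, mul_zero])
  · rintro ⟨rfl, hK⟩
    rw [star_eq_conjTranspose, fromBlocks_conjTranspose, fromBlocks_multiply, ← fromBlocks_one,
      fromBlocks_inj] at hW₁
    obtain ⟨hKK, hKM, -, -⟩ := hW₁
    simp only [Matrix.conjTranspose_zero, Matrix.zero_mul, Matrix.mul_zero, add_zero] at hKK hKM
    have hM : M = 0 := by
      rw [← conjTranspose_eq_zero, ← Matrix.one_mul Mᴴ, ← mul_eq_one_comm.mp hKK,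
        Matrix.mul_assoc, hKM, Matrix.mul_zero]
    subst hM
    simp [hK]

/-- The conjugation on dual complex numbers makes them a star ring. -/
@[reducible] def dualComplexStarRing : StarRing DC where
  star_involutive x := by
    refine TrivSqZeroExt.ext ?_ ?_
    · exact Complex.conj_conj x.fst
    · exact Complex.conj_conj x.snd
  star_mul x y := by
    refine TrivSqZeroExt.ext ?_ ?_
    · change (starRingEnd ℂ) (x * y).fst = (starRingEnd ℂ) y.fst * (starRingEnd ℂ) x.fst
      simp [mul_comm]
    · change (starRingEnd ℂ) (x * y).snd = (starRingEnd ℂ) y.fst * (starRingEnd ℂ) x.snd +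
        (starRingEnd ℂ) y.snd * (starRingEnd ℂ) x.fst
      simp [mul_comm, add_comm]
  star_add x y := by
    refine TrivSqZeroExt.ext ?_ ?_
    · exact map_add (starRingEnd ℂ) x.fst y.fst
    · exact map_add (starRingEnd ℂ) x.snd y.snd

theorem PosAppreciable.isUnit_add {x y : DC} (hx : PosAppreciable x) (hy : PosAppreciable y) :
    IsUnit (x + y) := by
  obtain ⟨⟨a, ha, hxa⟩, -⟩ := hx
  obtain ⟨⟨b, hb, hyb⟩, -⟩ := hy
  rw [TrivSqZeroExt.isUnit_iff_isUnit_fst, TrivSqZeroExt.fst_add, hxa, hyb, isUnit_iff_ne_zero]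
  exact_mod_cast (add_pos ha hb).ne'

theorem NonnegInfinitesimal.mul_self_eq_zero {x : DC} (hx : NonnegInfinitesimal x) :
    x * x = 0 := by
  refine TrivSqZeroExt.ext ?_ ?_ <;> simp [hx.1]

/-- Characterization of normal dual complex matrices. -/
theorem dualMatrix_normal_iff
    {r s : ℕ}
    -- `Û`, a unitary matrix
    (U : Matrix (Fin r ⊕ Fin s) (Fin r ⊕ Fin s) DC)
    (hU₁ : U * Uᴴ = 1) (hU₂ : Uᴴ * U = 1)
    -- the blocks `K, L, M, N` forming a unitary block matrix
    (K : Matrix (Fin r) (Fin r) DC) (L : Matrix (Fin r) (Fin s) DC)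
    (M : Matrix (Fin s) (Fin r) DC) (N : Matrix (Fin s) (Fin s) DC)
    (hW₁ : fromBlocks K L M N * (fromBlocks K L M N)ᴴ = 1)
    (hW₂ : (fromBlocks K L M N)ᴴ * fromBlocks K L M N = 1)
    -- `Σ₁` diagonal with positive appreciable real dual diagonal entries
    (S₁ : Matrix (Fin r) (Fin r) DC) (d₁ : Fin r → DC)
    (hS₁ : S₁ = Matrix.diagonal d₁) (hd₁ : ∀ i, PosAppreciable (d₁ i))
    -- `Σ₂` diagonal with nonnegative infinitesimal real dual diagonal entries
    (S₂ : Matrix (Fin s) (Fin s) DC) (d₂ : Fin s → DC)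
    (hS₂ : S₂ = Matrix.diagonal d₂) (hd₂ : ∀ i, NonnegInfinitesimal (d₂ i))
    -- the Hartwig–Spindelböck decomposition of `Â`
    (A : Matrix (Fin r ⊕ Fin s) (Fin r ⊕ Fin s) DC)
    (hA : A = U * fromBlocks (S₁ * K) (S₁ * L) (S₂ * M) (S₂ * N) * Uᴴ) :
    A * Aᴴ = Aᴴ * A ↔ L = 0 ∧ S₁ * K = K * S₁ := by
  subst hS₁ hS₂
  let _ := dualComplexStarRing
  exact hartwigSpindelbock_normal_iff hU₂ hW₁ hW₂ (fun i => (hd₁ i).star_eq)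
    (fun i j => (hd₁ i).isUnit_add (hd₁ j)) (fun i => (hd₂ i).star_eq)
    (fun i => (hd₂ i).mul_self_eq_zero) hA
end
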